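/- Let ε > ε(P). Then every H ∈ 𝓗 with (H•S)_T − ε‖H‖_p = 0 P-a.s. satisfies H_t = 0 P-a.s. for every t = 1,…,T. In particular, for every t the set E_{ε,t} consists only of random vectors vanishing P-a.s. -/

import Mathlib

open MeasureTheory Filter
open scoped ENNReal NNReal

noncomputable section

namespace QFTAP

/-- The `p`-norm on `ℝ^d`. -/
def pNorm {d : ℕ} (p : ℝ) (x : Fin d → ℝ) : ℝ := (∑ i, |x i| ^ p) ^ (1 / p)

/-- The norm dual to the `p`-norm, i.e. the `q`-norm where `1/p + 1/q = 1`
(`q = ∞` when `p = 1`, and `q = p/(p-1)` when `p > 1`). -/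
def qNorm {d : ℕ} (p : ℝ) (x : Fin d → ℝ) : ℝ :=
  if p = 1 then ⨆ i, |x i| else pNorm (p / (p - 1)) x

/-- Euclidean scalar product on `ℝ^d`. -/
def dot {d : ℕ} (x y : Fin d → ℝ) : ℝ := ∑ i, x i * y i

/-- The dual vector `x*` (with the convention `0* = 0`): `x*_i = sgn(x_i) |x_i|^{p-1} / |x|_p^{p-1}`. -/
def dualVec {d : ℕ} (p : ℝ) (x : Fin d → ℝ) : Fin d → ℝ :=
  fun i => Real.sign (x i) * |x i| ^ (p - 1) / (pNorm p x) ^ (p - 1)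

variable {Ω : Type*} [mΩ : MeasurableSpace Ω] {d : ℕ}

/-- A trading strategy: `H t` is `ℱ (t-1)`-measurable for every `t ≥ 1`. -/
def IsStrategy (ℱ : Filtration ℕ mΩ) (H : ℕ → Ω → Fin d → ℝ) : Prop :=
  ∀ t : ℕ, 1 ≤ t → StronglyMeasurable[ℱ (t - 1)] (H t)

/-- The terminal gain `(H • S)_T = ∑_{t=1}^T H_t · ΔS_t`. -/
def gain (S H : ℕ → Ω → Fin d → ℝ) (T : ℕ) (ω : Ω) : ℝ :=
  ∑ t ∈ Finset.Icc 1 T, dot (H t ω) (S t ω - S (t - 1) ω)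

/-- `‖H‖_p = ∑_{t=1}^T |H_t|_p`. -/
def stratNorm (p : ℝ) (H : ℕ → Ω → Fin d → ℝ) (T : ℕ) (ω : Ω) : ℝ :=
  ∑ t ∈ Finset.Icc 1 T, pNorm p (H t ω)

/-- `H` is a strict `ε`-arbitrage. -/
def IsStrictArb (P : Measure Ω) (ℱ : Filtration ℕ mΩ) (S : ℕ → Ω → Fin d → ℝ) (T : ℕ)
    (p ε : ℝ) (H : ℕ → Ω → Fin d → ℝ) : Prop :=
  IsStrategy ℱ H ∧
    (∀ᵐ ω ∂P, 0 ≤ gain S H T ω - ε * stratNorm p H T ω) ∧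
    0 < P {ω | 0 < gain S H T ω - ε * stratNorm p H T ω}

/-- A sequence of trading strategies is an `ε`-arbitrage. -/
def IsArb (P : Measure Ω) (ℱ : Filtration ℕ mΩ) (S : ℕ → Ω → Fin d → ℝ) (T : ℕ)
    (p ε : ℝ) (H : ℕ → ℕ → Ω → Fin d → ℝ) : Prop :=
  (∀ k, IsStrategy ℱ (H k)) ∧
    (∀ᵐ ω ∂P, 0 ≤ atTop.liminf fun k => gain S (H k) T ω - ε * stratNorm p (H k) T ω) ∧
    0 < P {ω | 0 < atTop.liminf fun k => gain S (H k) T ω - ε * stratNorm p (H k) T ω}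

/-- The market satisfies `NA_ε`: there is no `ε`-arbitrage. -/
def NA (P : Measure Ω) (ℱ : Filtration ℕ mΩ) (S : ℕ → Ω → Fin d → ℝ) (T : ℕ) (p ε : ℝ) : Prop :=
  ¬ ∃ H, IsArb P ℱ S T p ε H

/-- The critical value `ε(P) = inf {ε > 0 : no strict ε-arbitrage}`, with `inf ∅ = ∞`. -/
def criticalValue (P : Measure Ω) (ℱ : Filtration ℕ mΩ) (S : ℕ → Ω → Fin d → ℝ) (T : ℕ)
    (p : ℝ) : ℝ≥0∞ :=
  sInf {x : ℝ≥0∞ | ∃ ε : ℝ, 0 < ε ∧ (¬ ∃ H, IsStrictArb P ℱ S T p ε H) ∧ x = ENNReal.ofReal ε}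

/-- `Q` is an `ε`-martingale measure: `Q` is a probability measure equivalent to `P`,
`S_T ∈ L¹(Q)` and `|E_Q[S_t | ℱ_{t-1}] - S_{t-1}|_q ≤ ε` a.s. for all `t = 1,…,T`. -/
def IsEpsMartMeasure (P : Measure Ω) (ℱ : Filtration ℕ mΩ) (S : ℕ → Ω → Fin d → ℝ) (T : ℕ)
    (p ε : ℝ) (Q : Measure Ω) : Prop :=
  IsProbabilityMeasure Q ∧ Q ≪ P ∧ P ≪ Q ∧ Integrable (S T) Q ∧
    ∀ t : ℕ, 1 ≤ t → t ≤ T →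
      ∀ᵐ ω ∂Q, qNorm p ((Q[S t | ℱ (t - 1)]) ω - S (t - 1) ω) ≤ ε

/-- `𝓜_ε(P)`: the `ε`-martingale measures with `P`-essentially bounded density `dQ/dP`. -/
def Meps (P : Measure Ω) (ℱ : Filtration ℕ mΩ) (S : ℕ → Ω → Fin d → ℝ) (T : ℕ)
    (p ε : ℝ) : Set (Measure Ω) :=
  {Q | IsEpsMartMeasure P ℱ S T p ε Q ∧ ∃ C : ℝ≥0, ∀ᵐ ω ∂P, Q.rnDeriv P ω ≤ C}

/-- `K = {(H•S)_T - ε ‖H‖_p : H ∈ 𝓗}`. -/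
def Kset (ℱ : Filtration ℕ mΩ) (S : ℕ → Ω → Fin d → ℝ) (T : ℕ) (p ε : ℝ) : Set (Ω → ℝ) :=
  {X | ∃ H, IsStrategy ℱ H ∧ X = fun ω => gain S H T ω - ε * stratNorm p H T ω}

/-- `K̄`: the closure of `K` with respect to convergence in `P`-probability. -/
def Kbar (P : Measure Ω) (ℱ : Filtration ℕ mΩ) (S : ℕ → Ω → Fin d → ℝ) (T : ℕ)
    (p ε : ℝ) : Set (Ω → ℝ) :=
  {X | ∃ Y : ℕ → Ω → ℝ, (∀ n, Y n ∈ Kset ℱ S T p ε) ∧ TendstoInMeasure P Y atTop X}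

/-- `C = {X : ∃ Y ∈ K̄, X ≤ Y a.s.}`. -/
def Cset (P : Measure Ω) (ℱ : Filtration ℕ mΩ) (S : ℕ → Ω → Fin d → ℝ) (T : ℕ)
    (p ε : ℝ) : Set (Ω → ℝ) :=
  {X | ∃ Y ∈ Kbar P ℱ S T p ε, ∀ᵐ ω ∂P, X ω ≤ Y ω}

/-- `E_{ε,t} = {H_t ∈ 𝓗_t : H_t · ΔS_t = ε |H_t|_p a.s.}`. -/
def Eset (P : Measure Ω) (ℱ : Filtration ℕ mΩ) (S : ℕ → Ω → Fin d → ℝ)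
    (p ε : ℝ) (t : ℕ) : Set (Ω → Fin d → ℝ) :=
  {h | StronglyMeasurable[ℱ (t - 1)] h ∧
    ∀ᵐ ω ∂P, dot (h ω) (S t ω - S (t - 1) ω) = ε * pNorm p (h ω)}

/-- `E_{0,t} = {H_t ∈ 𝓗_t : H_t · ΔS_t = 0 a.s.}`. -/
def E0set (P : Measure Ω) (ℱ : Filtration ℕ mΩ) (S : ℕ → Ω → Fin d → ℝ)
    (t : ℕ) : Set (Ω → Fin d → ℝ) :=
  {h | StronglyMeasurable[ℱ (t - 1)] h ∧
    ∀ᵐ ω ∂P, dot (h ω) (S t ω - S (t - 1) ω) = 0}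

/-- `E_{0,t}^⊥`. -/
def E0perp (P : Measure Ω) (ℱ : Filtration ℕ mΩ) (S : ℕ → Ω → Fin d → ℝ)
    (t : ℕ) : Set (Ω → Fin d → ℝ) :=
  {h | StronglyMeasurable[ℱ (t - 1)] h ∧
    ∀ g ∈ E0set P ℱ S t, ∀ᵐ ω ∂P, dot (h ω) (g ω) = 0}

/-- `F_{ε,t} = {X_t ∈ 𝓗_t : X_t · H_t = |X_t|_q |H_t|_p a.s. for every H_t ∈ E_{ε,t}}`. -/
def Fset (P : Measure Ω) (ℱ : Filtration ℕ mΩ) (S : ℕ → Ω → Fin d → ℝ)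
    (p ε : ℝ) (t : ℕ) : Set (Ω → Fin d → ℝ) :=
  {X | StronglyMeasurable[ℱ (t - 1)] X ∧
    ∀ h ∈ Eset P ℱ S p ε t, ∀ᵐ ω ∂P, dot (X ω) (h ω) = qNorm p (X ω) * pNorm p (h ω)}

/-- `F_{ε,t}^⊥`, depending on a fixed maximal element `H̄_t` of `E_{ε,t}` when `p = 1`. -/
def Fperp (P : Measure Ω) (ℱ : Filtration ℕ mΩ) (S : ℕ → Ω → Fin d → ℝ)
    (p ε : ℝ) (t : ℕ) (Hb : Ω → Fin d → ℝ) : Set (Ω → Fin d → ℝ) :=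
  if p = 1 then
    {h | StronglyMeasurable[ℱ (t - 1)] h ∧
      (∀ᵐ ω ∂P, dot (dualVec 1 (Hb ω)) (h ω) = 0) ∧
      ∀ i, ∀ᵐ ω ∂P, Hb ω i = 0 → h ω i = 0}
  else
    {h | StronglyMeasurable[ℱ (t - 1)] h ∧
      ∀ X ∈ Fset P ℱ S p ε t, ∀ᵐ ω ∂P, dot (X ω) (h ω) = 0}

/-- `𝓗̄_t`: strategies supported on the support of `H̄_t` (componentwise when `p = 1`). -/
def HbarSpace (P : Measure Ω) (ℱ : Filtration ℕ mΩ) (p : ℝ) (t : ℕ)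
    (Hb : Ω → Fin d → ℝ) : Set (Ω → Fin d → ℝ) :=
  if p = 1 then
    {h | StronglyMeasurable[ℱ (t - 1)] h ∧ ∀ i, ∀ᵐ ω ∂P, Hb ω i = 0 → h ω i = 0}
  else
    {h | StronglyMeasurable[ℱ (t - 1)] h ∧ ∀ᵐ ω ∂P, Hb ω = 0 → h ω = 0}

/-- The defining properties of `H̄_t`: an element of `E_{ε,t}` with `|H̄_t|_p ∈ {0,1}` a.s. of
maximal support (componentwise maximal when `p = 1`). -/
def IsMaximalEps (P : Measure Ω) (ℱ : Filtration ℕ mΩ) (S : ℕ → Ω → Fin d → ℝ)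
    (p ε : ℝ) (t : ℕ) (Hb : Ω → Fin d → ℝ) : Prop :=
  Hb ∈ Eset P ℱ S p ε t ∧
    (∀ᵐ ω ∂P, pNorm p (Hb ω) = 0 ∨ pNorm p (Hb ω) = 1) ∧
    (1 < p → P {ω | Hb ω ≠ 0} = ⨆ h ∈ Eset P ℱ S p ε t, P {ω | h ω ≠ 0}) ∧
    (p = 1 → ∀ i, P {ω | Hb ω i ≠ 0} = ⨆ h ∈ Eset P ℱ S p ε t, P {ω | h ω i ≠ 0})

/-- `F_ε^⊥ = {G ∈ 𝓗 : G_t ∈ F_{ε,t}^⊥ for every t = 1,…,T}`. -/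
def FperpStrat (P : Measure Ω) (ℱ : Filtration ℕ mΩ) (S : ℕ → Ω → Fin d → ℝ) (T : ℕ)
    (p ε : ℝ) (Hb : ℕ → Ω → Fin d → ℝ) : Set (ℕ → Ω → Fin d → ℝ) :=
  {G | ∀ t, 1 ≤ t → t ≤ T → G t ∈ Fperp P ℱ S p ε t (Hb t)}

/-- The market satisfies `NA'_ε`. -/
def NAprime (P : Measure Ω) (ℱ : Filtration ℕ mΩ) (S : ℕ → Ω → Fin d → ℝ) (T : ℕ)
    (p ε : ℝ) (Hb : ℕ → Ω → Fin d → ℝ) : Prop :=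
  (¬ ∃ H, IsStrictArb P ℱ S T p ε H) ∧
    ∀ G ∈ FperpStrat P ℱ S T p ε Hb,
      (∀ᵐ ω ∂P, 0 ≤ gain S G T ω) → ∀ᵐ ω ∂P, gain S G T ω = 0

/-- `ψ` is an `ε`-fair price for `Ψ`. -/
def IsFairPrice (P : Measure Ω) (ℱ : Filtration ℕ mΩ) (S : ℕ → Ω → Fin d → ℝ) (T : ℕ)
    (p ε : ℝ) (Ψ : Ω → ℝ) (ψ : ℝ) : Prop :=
  ∀ (H : ℕ → ℕ → Ω → Fin d → ℝ) (a : ℕ → ℝ), (∀ k, IsStrategy ℱ (H k)) →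
    (∀ᵐ ω ∂P, 0 ≤ atTop.liminf fun k =>
      gain S (H k) T ω + a k * (Ψ ω - ψ) - ε * (stratNorm p (H k) T ω + |a k|)) →
    ∀ᵐ ω ∂P, atTop.liminf (fun k =>
      gain S (H k) T ω + a k * (Ψ ω - ψ) - ε * (stratNorm p (H k) T ω + |a k|)) = 0

lemma pNorm_nonneg {d : ℕ} (p : ℝ) (x : Fin d → ℝ) : 0 ≤ pNorm p x := by
  unfold pNorm
  positivity

lemma pNorm_eq_zero_iff {d : ℕ} {p : ℝ} (hp : 0 < p) {x : Fin d → ℝ} :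
    pNorm p x = 0 ↔ x = 0 := by
  have hsum : 0 ≤ ∑ i, |x i| ^ p := by positivity
  rw [pNorm, Real.rpow_eq_zero hsum (by positivity),
    Finset.sum_eq_zero_iff_of_nonneg fun i _ => by positivity, funext_iff]
  simp [Real.rpow_eq_zero, hp.ne']

lemma dot_zero_left {d : ℕ} (y : Fin d → ℝ) : dot 0 y = 0 := by
  simp [dot]

lemma stratNorm_nonneg {Ω : Type*} {d : ℕ} (p : ℝ) (H : ℕ → Ω → Fin d → ℝ) (T : ℕ) (ω : Ω) :
    0 ≤ stratNorm p H T ω :=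
  Finset.sum_nonneg fun _ _ => pNorm_nonneg p _

lemma eq_zero_of_stratNorm_eq_zero {Ω : Type*} {d : ℕ} {p : ℝ} (hp : 0 < p)
    {H : ℕ → Ω → Fin d → ℝ} {T : ℕ} {ω : Ω} (h : stratNorm p H T ω = 0)
    {t : ℕ} (ht : 1 ≤ t) (htT : t ≤ T) : H t ω = 0 :=
  (pNorm_eq_zero_iff hp).1 <|
    (Finset.sum_eq_zero_iff_of_nonneg fun _ _ => pNorm_nonneg p _).1 h t
      (Finset.mem_Icc.2 ⟨ht, htT⟩)

/-- Above the critical value, a cost level `ε' < ε` without strict arbitrage exists. -/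
lemma exists_lt_no_strictArb {Ω : Type*} [mΩ : MeasurableSpace Ω] {d T : ℕ} {P : Measure Ω}
    {ℱ : Filtration ℕ mΩ} {S : ℕ → Ω → Fin d → ℝ} {p ε : ℝ}
    (hε : criticalValue P ℱ S T p < ENNReal.ofReal ε) :
    ∃ ε' < ε, ¬ ∃ H, IsStrictArb P ℱ S T p ε' H := by
  obtain ⟨_, ⟨ε', -, hno, rfl⟩, hlt⟩ := sInf_lt_iff.1 hε
  exact ⟨ε', (ENNReal.ofReal_lt_ofReal_iff'.1 hlt).1, hno⟩

/-- If there is no strict `ε'`-arbitrage for some `ε' < ε`, then a strategy whose gain exactly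
covers the costs at level `ε` has zero norm. -/
lemma stratNorm_ae_eq_zero {Ω : Type*} [mΩ : MeasurableSpace Ω] {d T : ℕ} {P : Measure Ω}
    {ℱ : Filtration ℕ mΩ} {S : ℕ → Ω → Fin d → ℝ} {p ε ε' : ℝ} (hlt : ε' < ε)
    (hno : ¬ ∃ H, IsStrictArb P ℱ S T p ε' H) {H : ℕ → Ω → Fin d → ℝ}
    (hH : IsStrategy ℱ H) (h0 : ∀ᵐ ω ∂P, gain S H T ω - ε * stratNorm p H T ω = 0) :
    ∀ᵐ ω ∂P, stratNorm p H T ω = 0 := by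
  have hge : ∀ᵐ ω ∂P, 0 ≤ gain S H T ω - ε' * stratNorm p H T ω := by
    filter_upwards [h0] with ω hω
    nlinarith [stratNorm_nonneg p H T ω]
  have hnull : P {ω | 0 < gain S H T ω - ε' * stratNorm p H T ω} = 0 := by
    by_contra hpos
    exact hno ⟨H, hH, hge, pos_iff_ne_zero.2 hpos⟩
  filter_upwards [h0, measure_eq_zero_iff_ae_notMem.1 hnull] with ω hω hle
  rw [not_lt] at hle
  nlinarith [stratNorm_nonneg p H T ω]

/-- The strategy that invests `h` in period `t` and nothing in the other periods. -/
def singlePeriod {Ω : Type*} {d : ℕ} (t : ℕ) (h : Ω → Fin d → ℝ) : ℕ → Ω → Fin d → ℝ :=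
  Pi.single t h

lemma singlePeriod_self {Ω : Type*} {d : ℕ} (t : ℕ) (h : Ω → Fin d → ℝ) :
    singlePeriod t h t = h := by
  simp [singlePeriod]

lemma singlePeriod_of_ne {Ω : Type*} {d : ℕ} {s t : ℕ} (hst : s ≠ t) (h : Ω → Fin d → ℝ) :
    singlePeriod t h s = 0 := by
  simp [singlePeriod, hst]

lemma isStrategy_singlePeriod {Ω : Type*} [mΩ : MeasurableSpace Ω] {d : ℕ} {ℱ : Filtration ℕ mΩ}
    {t : ℕ} {h : Ω → Fin d → ℝ} (hh : StronglyMeasurable[ℱ (t - 1)] h) :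
    IsStrategy ℱ (singlePeriod t h) := by
  intro s _
  obtain rfl | hst := eq_or_ne s t
  · rwa [singlePeriod_self]
  · rw [singlePeriod_of_ne hst]
    exact stronglyMeasurable_zero

lemma gain_singlePeriod {Ω : Type*} {d T t : ℕ} (S : ℕ → Ω → Fin d → ℝ) (h : Ω → Fin d → ℝ)
    (ht : 1 ≤ t) (htT : t ≤ T) (ω : Ω) :
    gain S (singlePeriod t h) T ω = dot (h ω) (S t ω - S (t - 1) ω) := by
  rw [gain, Finset.sum_eq_single_of_mem t (Finset.mem_Icc.2 ⟨ht, htT⟩), singlePeriod_self]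
  intro s _ hst
  rw [singlePeriod_of_ne hst, Pi.zero_apply, dot_zero_left]

lemma stratNorm_singlePeriod {Ω : Type*} {d T t : ℕ} {p : ℝ} (hp : 0 < p) (h : Ω → Fin d → ℝ)
    (ht : 1 ≤ t) (htT : t ≤ T) (ω : Ω) :
    stratNorm p (singlePeriod t h) T ω = pNorm p (h ω) := by
  rw [stratNorm, Finset.sum_eq_single_of_mem t (Finset.mem_Icc.2 ⟨ht, htT⟩), singlePeriod_self]
  intro s _ hst
  rw [singlePeriod_of_ne hst, Pi.zero_apply, (pNorm_eq_zero_iff hp).2 rfl]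

/-- For `ε > ε(P)`, every strategy `H` with `(H•S)_T - ε‖H‖_p = 0` a.s.
vanishes a.s.; in particular `E_{ε,t}` consists only of a.s. vanishing random vectors. -/
theorem strict_zero_above_critical_value
    {Ω : Type*} [mΩ : MeasurableSpace Ω] {d T : ℕ}
    (P : Measure Ω) [IsProbabilityMeasure P] (ℱ : Filtration ℕ mΩ)
    (S : ℕ → Ω → Fin d → ℝ) (hS : Adapted ℱ S)
    (hd : 1 ≤ d) (hT : 1 ≤ T) (p ε : ℝ) (hp : 1 ≤ p)
    (hε : criticalValue P ℱ S T p < ENNReal.ofReal ε) :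
    (∀ H, IsStrategy ℱ H →
      (∀ᵐ ω ∂P, gain S H T ω - ε * stratNorm p H T ω = 0) →
      ∀ t, 1 ≤ t → t ≤ T → ∀ᵐ ω ∂P, H t ω = 0) ∧
    (∀ t, 1 ≤ t → t ≤ T → ∀ h ∈ Eset P ℱ S p ε t, ∀ᵐ ω ∂P, h ω = 0) := by
  have hp0 : 0 < p := zero_lt_one.trans_le hp
  obtain ⟨ε', hlt, hno⟩ := exists_lt_no_strictArb hε
  have hzero : ∀ H, IsStrategy ℱ H →
      (∀ᵐ ω ∂P, gain S H T ω - ε * stratNorm p H T ω = 0) →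
      ∀ t, 1 ≤ t → t ≤ T → ∀ᵐ ω ∂P, H t ω = 0 := by
    intro H hH h0 t ht htT
    filter_upwards [stratNorm_ae_eq_zero hlt hno hH h0] with ω hω
    exact eq_zero_of_stratNorm_eq_zero hp0 hω ht htT
  refine ⟨hzero, fun t ht htT h hh => ?_⟩
  have key := hzero (singlePeriod t h) (isStrategy_singlePeriod hh.1) ?_ t ht htT
  · rwa [singlePeriod_self] at key
  · filter_upwards [hh.2] with ω hω
    rw [gain_singlePeriod S h ht htT, stratNorm_singlePeriod hp0 h ht htT, hω, sub_self]

end QFTAP
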